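/- Let X be a stationary ergodic finite-alphabet process and Y i.i.d. with full-support marginal Q on the same alphabet A, with ρ(x,y) = 0 iff x = y. Then the double limit as n → ∞ and D ↓ 0 of (1/n) log [ P_n(B(X₁ⁿ,D)) / Qⁿ(B(X₁ⁿ,D)) ] exists almost surely and equals the relative entropy rate H(ℙ‖ℚ) = lim_n (1/n) H(P_n‖Qⁿ). -/

import Mathlib

open MeasureTheory Real Filter

namespace DVB

set_option linter.unusedSectionVars false

section General
variable {X : Type*} [MeasurableSpace X] {μ : Measure X} [IsProbabilityMeasure μ] {T : X → X}

/-- Zero-one dichotomy for sub-invariant sequences. -/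
lemma dichotomy (hT : Ergodic T μ) (u : ℕ → X → ℝ) (hu : ∀ n, Measurable (u n)) (B : ℝ)
    (hsub : ∀ᵐ x ∂μ, ∀ n, u n (T x) ≤ u (n + 1) x + B) (c : ℝ) :
    (∀ᵐ x ∂μ, ∀ᶠ n : ℕ in atTop, c * n < u n x) ∨
    (∀ᵐ x ∂μ, ∃ K : ℕ, ∃ᶠ n : ℕ in atTop, u n x ≤ c * n + K) := by
  set E : Set X := {x | ∃ K : ℕ, ∃ᶠ n : ℕ in atTop, u n x ≤ c * n + K} with hE
  have hEm : MeasurableSet E := by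
    have : E = ⋃ K : ℕ, ⋂ N : ℕ, ⋃ n : ℕ, ⋃ _ : N ≤ n, {x | u n x ≤ c * n + K} := by
      ext x
      simp [hE, frequently_atTop]
    rw [this]
    refine MeasurableSet.iUnion fun K => MeasurableSet.iInter fun N => MeasurableSet.iUnion fun n =>
      MeasurableSet.iUnion fun _ => measurableSet_le (hu n) measurable_const
  have hinv : E ≤ᵐ[μ] T ⁻¹' E := by
    filter_upwards [hsub] with x hx hxE
    obtain ⟨K, hK⟩ := hxE
    obtain ⟨K', hK'⟩ := exists_nat_ge (K + |c| + B)
    refine ⟨K', ?_⟩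
    rw [frequently_atTop] at hK ⊢
    intro N
    obtain ⟨n, hn, hn'⟩ := hK (N + 1)
    obtain ⟨m, rfl⟩ : ∃ m, n = m + 1 := ⟨n - 1, by omega⟩
    refine ⟨m, by omega, ?_⟩
    have h1 := hx m
    have h2 := le_abs_self c
    push_cast at hn'
    linarith
  rcases hT.ae_empty_or_univ_of_ae_le_preimage hEm.nullMeasurableSet hinv with h | h
  · left
    have h0 : ∀ᵐ x ∂μ, x ∉ E := by
      filter_upwards [h] with x hx hxE
      have : (x ∈ E) = (x ∈ (∅ : Set X)) := hx
      simp [this] at hxE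
    filter_upwards [h0] with x hx
    by_contra hcon
    apply hx
    refine ⟨0, ?_⟩
    rw [not_eventually] at hcon
    refine hcon.mono fun n hn => ?_
    push Not at hn
    simpa using hn
  · right
    filter_upwards [h] with x hx
    have : (x ∈ E) = (x ∈ (Set.univ : Set X)) := hx
    have h2 : x ∈ E := by rw [this]; trivial
    exact h2

/-- Pointwise greedy tiling bound. -/
lemma tile_pointwise (V : ℕ → X → ℝ) (C c : ℝ) (hC : 0 ≤ C)
    (h0 : ∀ x, V 0 x ≤ 0) (h1 : ∀ n x, V (n + 1) x ≤ C + V n (T x))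
    (G : ℕ → Set X)
    (hG : ∀ L n x, x ∈ G L → V (n + L) x ≤ c * L + V n (T^[L] x))
    (N : ℕ) (Bad : Set X) (hBad : ∀ x, x ∉ Bad → ∃ L, 1 ≤ L ∧ L ≤ N ∧ x ∈ G L) :
    ∀ n x, V n x ≤ c * n + (C + |c|) *
      birkhoffSum T (Bad.indicator (fun _ => (1 : ℝ))) n x + (C + |c|) * N := by
  have hD : 0 ≤ C + |c| := by positivity
  have hind : ∀ x, 0 ≤ Bad.indicator (fun _ => (1 : ℝ)) x := fun x =>
    Set.indicator_nonneg (fun _ _ => zero_le_one) x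
  have hpos : ∀ n x, 0 ≤ birkhoffSum T (Bad.indicator (fun _ => (1 : ℝ))) n x := fun n x =>
    Finset.sum_nonneg fun i _ => hind _
  have htriv : ∀ n x, V n x ≤ C * n := by
    intro n
    induction n with
    | zero => intro x; simpa using h0 x
    | succ n ih =>
      intro x
      have := h1 n x
      have := ih (T x)
      push_cast
      linarith
  have hc1 := le_abs_self c
  have hc2 := neg_abs_le c
  intro n
  induction n using Nat.strong_induction_on with
  | _ n ih =>
    intro x
    rcases Nat.eq_zero_or_pos n with rfl | hn
    · have := h0 x
      have : 0 ≤ (C + |c|) * N := by positivity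
      simp [birkhoffSum]
      linarith
    by_cases hx : x ∈ Bad
    · obtain ⟨m, rfl⟩ : ∃ m, n = m + 1 := ⟨n - 1, by omega⟩
      have a1 := h1 m x
      have a2 := ih m (by omega) (T x)
      rw [birkhoffSum_succ']
      simp only [Set.indicator_of_mem hx]
      push_cast
      nlinarith
    · obtain ⟨L, hL1, hLN, hxL⟩ := hBad x hx
      by_cases hLn : L ≤ n
      · obtain ⟨m, rfl⟩ : ∃ m, n = m + L := ⟨n - L, by omega⟩
        have a1 := hG L m x hxL
        have a2 := ih m (by omega) (T^[L] x)
        have a3 := birkhoffSum_add T (Bad.indicator (fun _ => (1 : ℝ))) L m x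
        rw [add_comm L m] at a3
        rw [a3]
        have := mul_nonneg hD (hpos L x)
        push_cast
        nlinarith
      · have a1 := htriv n x
        have a2 := mul_nonneg hD (hpos n x)
        have a3 : (n : ℝ) ≤ N := by exact_mod_cast (by omega : n ≤ N)
        have a4 := mul_le_mul_of_nonneg_left a3 hD
        have a5 : (0 : ℝ) ≤ n := by positivity
        nlinarith

lemma integral_birkhoffSum (hT : MeasurePreserving T μ μ) (φ : X → ℝ) (hφ : Integrable φ μ) (n : ℕ) :
    Integrable (birkhoffSum T φ n) μ ∧ ∫ x, birkhoffSum T φ n x ∂μ = n * ∫ x, φ x ∂μ := by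
  have hi : ∀ k, Integrable (fun x => φ (T^[k] x)) μ := fun k =>
    (hT.iterate k).integrable_comp_of_integrable hφ
  constructor
  · exact integrable_finsetSum _ fun k _ => hi k
  · simp only [birkhoffSum]
    rw [integral_finsetSum _ fun k _ => hi k]
    have : ∀ k, ∫ x, φ (T^[k] x) ∂μ = ∫ x, φ x ∂μ := by
      intro k
      have hm := hT.iterate k
      have h2 := integral_map (μ := μ) hm.measurable.aemeasurable (f := φ)
        (by rw [hm.map_eq]; exact hφ.aestronglyMeasurable)
      rw [hm.map_eq] at h2
      exact h2.symm
    simp [this]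

lemma tile_integral (hT : MeasurePreserving T μ μ) (V : ℕ → X → ℝ) (hV : ∀ n, Integrable (V n) μ)
    (C c : ℝ) (hC : 0 ≤ C)
    (h0 : ∀ x, V 0 x ≤ 0) (h1 : ∀ n x, V (n + 1) x ≤ C + V n (T x))
    (G : ℕ → Set X) (hGm : ∀ L, MeasurableSet (G L))
    (hG : ∀ L n x, x ∈ G L → V (n + L) x ≤ c * L + V n (T^[L] x))
    (hae : ∀ᵐ x ∂μ, ∃ L, 1 ≤ L ∧ x ∈ G L) (ε : ℝ) (hε : 0 < ε) :
    ∃ K : ℝ, ∀ n, ∫ x, V n x ∂μ ≤ (c + ε) * n + K := by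
  have hD : 0 ≤ C + |c| := by positivity
  set Bad : ℕ → Set X := fun N => ⋂ L : ℕ, ⋂ _ : 1 ≤ L, ⋂ _ : L ≤ N, (G L)ᶜ with hBad
  have hBm : ∀ N, MeasurableSet (Bad N) := fun N =>
    MeasurableSet.iInter fun L => MeasurableSet.iInter fun _ => MeasurableSet.iInter fun _ =>
      (hGm L).compl
  have hanti : Antitone Bad := by
    intro N M hNM x hx
    simp only [hBad, Set.mem_iInter] at hx ⊢
    exact fun L h1 h2 => hx L h1 (h2.trans hNM)
  have hlim : Tendsto (fun N => μ.real (Bad N)) atTop (nhds 0) := by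
    have h := tendsto_measure_iInter_atTop (μ := μ) (fun N => (hBm N).nullMeasurableSet) hanti
      ⟨0, measure_ne_top _ _⟩
    have h0 : μ (⋂ N, Bad N) = 0 := by
      rw [measure_eq_zero_iff_ae_notMem]
      filter_upwards [hae] with x ⟨L, hL, hxL⟩ hx
      simp only [hBad, Set.mem_iInter] at hx
      exact hx L L hL le_rfl hxL
    rw [h0] at h
    have := (ENNReal.tendsto_toReal ENNReal.zero_ne_top).comp h
    rw [ENNReal.toReal_zero] at this
    exact this
  have hev : ∀ᶠ N in atTop, (C + |c|) * μ.real (Bad N) < ε := by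
    have := hlim.const_mul (C + |c|)
    rw [mul_zero] at this
    exact this.eventually_lt_const hε
  obtain ⟨N, hN⟩ := hev.exists
  refine ⟨(C + |c|) * N, fun n => ?_⟩
  have hp := tile_pointwise V C c hC h0 h1 G hG N (Bad N) (by
    intro x hx
    simp only [hBad, Set.mem_iInter, not_forall] at hx
    obtain ⟨L, h1, h2, h3⟩ := hx
    exact ⟨L, h1, h2, by simpa using h3⟩) n
  have hintg : Integrable ((Bad N).indicator (fun _ => (1 : ℝ))) μ :=
    (integrable_const _).indicator (hBm N)
  obtain ⟨hi, he⟩ := integral_birkhoffSum hT _ hintg n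
  have hm := integral_mono (hV n)
    (((integrable_const (c * n)).add (hi.const_mul (C + |c|))).add
      (integrable_const ((C + |c|) * N))) hp
  refine hm.trans ?_
  simp only [Pi.add_apply]
  rw [integral_add (by exact (integrable_const (c * n)).add (hi.const_mul (C + |c|)))
    (integrable_const _), integral_add (integrable_const _) (hi.const_mul _),
    integral_const_mul (C + |c|), he, integral_indicator_const _ (hBm N)]
  simp only [integral_const, probReal_univ, smul_eq_mul, mul_one]
  have : (n : ℝ) * ((C + |c|) * μ.real (Bad N)) ≤ n * ε :=
    mul_le_mul_of_nonneg_left hN.le (by positivity)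
  nlinarith

lemma le_of_linear {a b K : ℝ} (h : ∀ n : ℕ, n * a ≤ b * n + K) : a ≤ b := by
  by_contra hab
  push Not at hab
  obtain ⟨n, hn⟩ := exists_nat_gt (K / (a - b))
  rw [div_lt_iff₀ (by linarith)] at hn
  have := h n
  nlinarith

lemma birkhoff_lower (hT : Ergodic T μ) (φ : X → ℝ) (hφ : Measurable φ) (B : ℝ)
    (hB : ∀ x, |φ x| ≤ B) (c : ℝ) (hc : c < ∫ x, φ x ∂μ) :
    ∀ᵐ x ∂μ, ∀ᶠ n : ℕ in atTop, c * n < birkhoffSum T φ n x := by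
  have hTm : Measurable T := hT.measurable
  have hintg : Integrable φ μ := Integrable.of_bound hφ.aestronglyMeasurable B (ae_of_all _ hB)
  have hS : ∀ n, Measurable (birkhoffSum T φ n) := fun n =>
    Finset.measurable_fun_sum _ fun k _ => hφ.comp (hTm.iterate k)
  obtain ⟨ε, hε, hε2⟩ : ∃ ε > 0, c + 2 * ε < ∫ x, φ x ∂μ :=
    ⟨((∫ x, φ x ∂μ) - c) / 4, by linarith, by linarith⟩
  rcases dichotomy hT (birkhoffSum T φ) hS B (by
    refine ae_of_all _ fun x n => ?_
    rw [birkhoffSum_succ']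
    have := (abs_le.1 (hB x)).1
    linarith) c with h | h
  · exact h
  · exfalso
    obtain ⟨K, hK⟩ := tile_integral (μ := μ) hT.toMeasurePreserving (birkhoffSum T φ)
      (fun n => (integral_birkhoffSum hT.toMeasurePreserving φ hintg n).1) |B| (c + ε) (abs_nonneg _)
      (by intro x; simp [birkhoffSum]) (by
        intro n x
        rw [birkhoffSum_succ']
        have := (abs_le.1 (hB x)).2
        have := le_abs_self B
        linarith)
      (fun L => {x | birkhoffSum T φ L x ≤ (c + ε) * L})
      (fun L => measurableSet_le (hS L) measurable_const) (by
        intro L n x hx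
        rw [add_comm n L, birkhoffSum_add]
        have hx' : birkhoffSum T φ L x ≤ (c + ε) * L := hx
        linarith) (by
        filter_upwards [h] with x ⟨K, hK⟩
        obtain ⟨M, hM⟩ := exists_nat_ge (K / ε)
        obtain ⟨n, hn, hn2⟩ := (frequently_atTop.1 hK) (M + 1)
        refine ⟨n, by omega, ?_⟩
        show birkhoffSum T φ n x ≤ (c + ε) * n
        rw [div_le_iff₀ hε] at hM
        have : (M : ℝ) ≤ n := by exact_mod_cast (by omega : M ≤ n)
        nlinarith) (ε / 2) (by linarith)
    have := le_of_linear (a := ∫ x, φ x ∂μ) (b := c + ε + ε / 2) (K := K) (fun n => by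
      rw [← (integral_birkhoffSum hT.toMeasurePreserving φ hintg n).2]; exact hK n)
    linarith

lemma birkhoff_upper (hT : Ergodic T μ) (φ : X → ℝ) (hφ : Measurable φ) (B : ℝ)
    (hB : ∀ x, |φ x| ≤ B) (c : ℝ) (hc : ∫ x, φ x ∂μ < c) :
    ∀ᵐ x ∂μ, ∀ᶠ n : ℕ in atTop, birkhoffSum T φ n x < c * n := by
  have := birkhoff_lower hT (fun x => - φ x) hφ.neg B (by simpa using hB) (-c)
    (by rw [integral_neg]; linarith)
  filter_upwards [this] with x hx
  filter_upwards [hx] with n hn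
  have : birkhoffSum T (fun x => - φ x) n x = - birkhoffSum T φ n x := by
    simp [birkhoffSum]
  linarith

/-- From one-sided bounds to convergence of averages. -/
lemma tendsto_of_bounds (u : ℕ → X → ℝ) (h : ℝ)
    (hlo : ∀ c < h, ∀ᵐ x ∂μ, ∀ᶠ n : ℕ in atTop, c * n ≤ u n x)
    (hup : ∀ c > h, ∀ᵐ x ∂μ, ∀ᶠ n : ℕ in atTop, u n x ≤ c * n) :
    ∀ᵐ x ∂μ, Tendsto (fun n : ℕ => (n : ℝ)⁻¹ * u n x) atTop (nhds h) := by
  have h1 : ∀ᵐ x ∂μ, ∀ k : ℕ, ∀ᶠ n : ℕ in atTop, (h - 1 / ((k : ℝ) + 1)) * n ≤ u n x :=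
    ae_all_iff.2 fun k => hlo _ (by linarith [Nat.one_div_pos_of_nat (α := ℝ) (n := k)])
  have h2 : ∀ᵐ x ∂μ, ∀ k : ℕ, ∀ᶠ n : ℕ in atTop, u n x ≤ (h + 1 / ((k : ℝ) + 1)) * n :=
    ae_all_iff.2 fun k => hup _ (by linarith [Nat.one_div_pos_of_nat (α := ℝ) (n := k)])
  filter_upwards [h1, h2] with x h1 h2
  rw [Metric.tendsto_atTop']
  intro ε hε
  obtain ⟨k, hk⟩ := exists_nat_one_div_lt hε
  obtain ⟨N, hN⟩ := eventually_atTop.1 ((h1 k).and ((h2 k).and (eventually_gt_atTop 0)))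
  refine ⟨N, fun n hn => ?_⟩
  obtain ⟨a1, a2, a3⟩ := hN n hn.le
  have hnpos : (0 : ℝ) < n := by exact_mod_cast a3
  rw [Real.dist_eq, abs_lt]
  have b1 := (le_div_iff₀ hnpos).2 a1
  have b2 := (div_le_iff₀ hnpos).2 a2
  rw [div_eq_inv_mul (u n x)] at b1 b2
  constructor <;> linarith

end General

section Words
variable {A : Type*} [MeasurableSpace A] [MeasurableSingletonClass A] [Fintype A]

/-- First `n` letters. -/
def rr (n : ℕ) (x : ℕ → A) : Fin n → A := fun i => x i

/-- The shift. -/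
def sh (x : ℕ → A) : ℕ → A := fun n => x (n + 1)

/-- Cylinder sets. -/
def cyl (n : ℕ) (x : ℕ → A) : Set (ℕ → A) := {z | ∀ i < n, z i = x i}

/-- Word probability. -/
noncomputable def wp (ν : Measure (ℕ → A)) (n : ℕ) (s : Fin n → A) : ℝ :=
  ((ν.map (fun x (i : Fin n) => x i)) {s}).toReal

/-- Cylinder probability. -/
noncomputable def cp (ν : Measure (ℕ → A)) (n : ℕ) (x : ℕ → A) : ℝ := wp ν n (rr n x)

lemma measurable_rr (n : ℕ) : Measurable (rr n : (ℕ → A) → (Fin n → A)) :=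
  measurable_pi_iff.2 fun i => measurable_pi_apply _

lemma wp_nonneg (ν : Measure (ℕ → A)) (n : ℕ) (s : Fin n → A) : 0 ≤ wp ν n s :=
  ENNReal.toReal_nonneg

lemma preimage_rr (n : ℕ) (x : ℕ → A) : rr n ⁻¹' {rr n x} = cyl n x := by
  ext z
  simp only [Set.mem_preimage, Set.mem_singleton_iff, cyl, funext_iff, rr, Set.mem_ofPred_eq]
  exact ⟨fun h i hi => h ⟨i, hi⟩, fun h i => h i i.2⟩

lemma cp_eq (ν : Measure (ℕ → A)) (n : ℕ) (x : ℕ → A) : cp ν n x = ν.real (cyl n x) := by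
  have : (ν.map (rr n)) {rr n x} = ν (cyl n x) := by
    rw [Measure.map_apply (measurable_rr n) (measurableSet_singleton _), preimage_rr]
  exact congrArg ENNReal.toReal this

lemma measurableSet_cyl (n : ℕ) (x : ℕ → A) : MeasurableSet (cyl n x) := by
  rw [← preimage_rr]; exact measurable_rr n (measurableSet_singleton _)

lemma cp_nonneg (ν : Measure (ℕ → A)) (n : ℕ) (x : ℕ → A) : 0 ≤ cp ν n x := wp_nonneg _ _ _

lemma real_preimage (ν : Measure (ℕ → A)) [IsFiniteMeasure ν] (n : ℕ) (S : Finset (Fin n → A)) :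
    ν.real (rr n ⁻¹' (S : Set (Fin n → A))) = ∑ s ∈ S, wp ν n s := by
  have h : (ν.map (rr n)).real (S : Set (Fin n → A)) = ν.real (rr n ⁻¹' (S : Set (Fin n → A))) :=
    map_measureReal_apply (measurable_rr n) S.measurableSet
  rw [← h, ← sum_measureReal_singleton]
  rfl

lemma sum_wp (ν : Measure (ℕ → A)) [IsFiniteMeasure ν] (n : ℕ) :
    ∑ s, wp ν n s = ν.real Set.univ := by
  rw [← real_preimage]; simp

lemma integrable_rr (ν : Measure (ℕ → A)) [IsFiniteMeasure ν] (n : ℕ) (f : (Fin n → A) → ℝ) :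
    Integrable (fun x => f (rr n x)) ν := by
  have : Integrable f (ν.map (rr n)) := Integrable.of_finite
  exact this.comp_measurable (measurable_rr n)

lemma measurable_comp_rr (n : ℕ) (f : (Fin n → A) → ℝ) :
    Measurable (fun x : ℕ → A => f (rr n x)) :=
  (measurable_of_finite f).comp (measurable_rr n)

lemma integral_rr (ν : Measure (ℕ → A)) [IsFiniteMeasure ν] (n : ℕ) (f : (Fin n → A) → ℝ) :
    ∫ x, f (rr n x) ∂ν = ∑ s, wp ν n s * f s := by
  have hi : Integrable f (ν.map (rr n)) := Integrable.of_finite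
  have := integral_map (μ := ν) (measurable_rr n).aemeasurable hi.aestronglyMeasurable
  rw [← this, integral_fintype hi]
  rfl

lemma cp_pos_ae (ν : Measure (ℕ → A)) [IsFiniteMeasure ν] : ∀ᵐ x ∂ν, ∀ n, 0 < cp ν n x := by
  rw [ae_all_iff]
  intro n
  have : ∀ᵐ s ∂(ν.map (rr n)), (ν.map (rr n)) {s} ≠ 0 := by
    rw [ae_iff_of_countable]
    exact fun s hs => hs
  have h2 := ae_of_ae_map (measurable_rr n).aemeasurable this
  filter_upwards [h2] with x hx
  exact ENNReal.toReal_pos hx (measure_ne_top _ _)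

/-- Comparison of a sub-probability with the true one along a typical path. -/
lemma compare_ae (P : Measure (ℕ → A)) [IsProbabilityMeasure P] (θ : ∀ n, (Fin n → A) → ℝ)
    (h0 : ∀ n s, 0 ≤ θ n s) (h1 : ∀ n, ∑ s, θ n s ≤ 1) (ε : ℝ) (hε : 0 < ε) :
    ∀ᵐ x ∂P, ∀ᶠ n : ℕ in atTop, θ n (rr n x) ≤ exp (ε * n) * cp P n x := by
  classical
  let S : ∀ n, Finset (Fin n → A) := fun n =>
    Finset.univ.filter fun s => exp (ε * n) * wp P n s < θ n s
  have hb : ∀ n : ℕ, P (rr n ⁻¹' (S n : Set (Fin n → A))) ≤ ENNReal.ofReal (exp (-ε) ^ n) := by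
    intro n
    rw [← ofReal_measureReal]
    apply ENNReal.ofReal_le_ofReal
    rw [real_preimage, ← Real.exp_nat_mul]
    calc ∑ s ∈ S n, wp P n s ≤ ∑ s ∈ S n, exp (n * -ε) * θ n s := by
          refine Finset.sum_le_sum fun s hs => ?_
          have hs' : exp (ε * n) * wp P n s < θ n s := (Finset.mem_filter.1 hs).2
          have h3 := mul_le_mul_of_nonneg_left hs'.le (exp_pos (n * -ε)).le
          rw [← mul_assoc, ← Real.exp_add] at h3
          have : (n : ℝ) * -ε + ε * n = 0 := by ring
          rw [this, Real.exp_zero, one_mul] at h3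
          exact h3
      _ ≤ ∑ s, exp (n * -ε) * θ n s :=
          Finset.sum_le_sum_of_subset_of_nonneg (Finset.subset_univ _)
            fun s _ _ => mul_nonneg (exp_pos _).le (h0 n s)
      _ ≤ exp (n * -ε) := by
          rw [← Finset.mul_sum]
          exact mul_le_of_le_one_right (exp_pos _).le (h1 n)
  have hsum : Summable (fun n : ℕ => exp (-ε) ^ n) :=
    summable_geometric_of_lt_one (exp_pos _).le (by rw [Real.exp_lt_one_iff]; linarith)
  have hne : ∑' n, P (rr n ⁻¹' (S n : Set (Fin n → A))) ≠ ⊤ :=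
    ne_top_of_le_ne_top hsum.tsum_ofReal_ne_top (ENNReal.tsum_le_tsum hb)
  filter_upwards [ae_eventually_notMem hne] with x hx
  filter_upwards [hx] with n hn
  have : ¬ (exp (ε * n) * wp P n (rr n x) < θ n (rr n x)) := by
    intro hlt
    apply hn
    simp only [Set.mem_preimage, Finset.mem_coe]
    exact Finset.mem_filter.2 ⟨Finset.mem_univ _, hlt⟩
  exact not_lt.1 this

/-- Gibbs inequality. -/
lemma gibbs (P : Measure (ℕ → A)) [IsProbabilityMeasure P] (n : ℕ) (θ : (Fin n → A) → ℝ)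
    (h0 : ∀ s, 0 < θ s) (h1 : ∑ s, θ s ≤ 1) :
    ∫ x, - log (cp P n x) ∂P ≤ ∫ x, - log (θ (rr n x)) ∂P := by
  have e1 := integral_rr P n (fun s => - log (wp P n s))
  have e2 := integral_rr P n (fun s => - log (θ s))
  have e3 : ∑ s, wp P n s = 1 := by rw [sum_wp]; simp
  have : ∑ s, (wp P n s * -log (wp P n s) - wp P n s * - log (θ s)) ≤ ∑ s, (θ s - wp P n s) := by
    refine Finset.sum_le_sum fun s _ => ?_
    rcases (wp_nonneg P n s).eq_or_lt with h | h
    · rw [← h]; simp [(h0 s).le]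
    · have h2 := Real.log_le_sub_one_of_pos (div_pos (h0 s) h)
      rw [Real.log_div (h0 s).ne' h.ne'] at h2
      have h3 := mul_le_mul_of_nonneg_left h2 h.le
      have h4 : wp P n s * (θ s / wp P n s - 1) = θ s - wp P n s := by field_simp
      rw [h4] at h3
      linarith
  rw [Finset.sum_sub_distrib, Finset.sum_sub_distrib, e3] at this
  have e1' : ∫ x, - log (cp P n x) ∂P = ∑ s, wp P n s * - log (wp P n s) := e1
  rw [e1', e2]
  linarith

end Words

section Renewal
variable {A : Type*} [MeasurableSpace A] [MeasurableSingletonClass A] [Fintype A]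

lemma sh_iterate (L : ℕ) (x : ℕ → A) (i : ℕ) : (sh^[L] x) i = x (i + L) := by
  induction L generalizing x i with
  | zero => rfl
  | succ L ih =>
    rw [Function.iterate_succ_apply, ih]
    simp only [sh]
    congr 1

/-- Concatenation of the first `L` letters of one sequence with another sequence. -/
def cat (L : ℕ) (z : (ℕ → A) × (ℕ → A)) : ℕ → A := fun i => if i < L then z.1 i else z.2 (i - L)

lemma measurable_cat (L : ℕ) : Measurable (cat L : (ℕ → A) × (ℕ → A) → ℕ → A) := by
  refine measurable_pi_iff.2 fun i => ?_
  by_cases h : i < L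
  · simp only [cat, h, if_true]; fun_prop
  · simp only [cat, h, if_false]; fun_prop

/-- Block-length weights. -/
noncomputable def wt (L : ℕ) : ℝ := 1 / ((L + 1 : ℝ) * (L + 2))

lemma wt_pos (L : ℕ) : 0 < wt L := by unfold wt; positivity

lemma wt_le_one (L : ℕ) : wt L ≤ 1 := by
  unfold wt
  rw [div_le_one (by positivity)]
  have : (0 : ℝ) ≤ L := by positivity
  nlinarith

lemma sum_wt (n : ℕ) : ∑ L : Fin n, wt L ≤ 1 := by
  rw [Fin.sum_univ_eq_sum_range]
  have : ∑ L ∈ Finset.range n, wt L = 1 - 1 / (n + 1 : ℝ) := by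
    induction n with
    | zero => simp
    | succ n ih =>
      rw [Finset.sum_range_succ, ih]
      unfold wt
      push_cast
      field_simp
      ring
  rw [this]
  have : (0 : ℝ) ≤ 1 / (n + 1 : ℝ) := by positivity
  linarith

/-- Laws of random concatenations of blocks drawn from `R`. -/
noncomputable def nu (R : Measure (ℕ → A)) (n : ℕ) : Measure (ℕ → A) :=
  if n = 0 then R else
    ∑ L : Fin n, ENNReal.ofReal (wt L) • (R.prod (nu R (n - 1 - L))).map (cat (L + 1))
termination_by n
decreasing_by omega

variable (R : Measure (ℕ → A)) [IsProbabilityMeasure R]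

lemma nu_zero : nu R 0 = R := by rw [nu]; simp

lemma nu_mass (n : ℕ) : nu R n Set.univ ≤ 1 := by
  induction n using Nat.strong_induction_on with
  | _ n ih =>
    rw [nu]
    split_ifs with h
    · simp
    · simp only [Measure.coe_finsetSum, Finset.sum_apply, Measure.coe_smul, Pi.smul_apply, smul_eq_mul]
      calc ∑ L : Fin n, ENNReal.ofReal (wt L) *
            ((R.prod (nu R (n - 1 - L))).map (cat (L + 1))) Set.univ
          ≤ ∑ L : Fin n, ENNReal.ofReal (wt L) * 1 := by
            refine Finset.sum_le_sum fun L _ => ?_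
            gcongr
            have hL := L.2
            have h1 := ih (n - 1 - L) (by omega)
            have : IsFiniteMeasure (nu R (n - 1 - L)) := ⟨h1.trans_lt ENNReal.one_lt_top⟩
            rw [Measure.map_apply (measurable_cat _) MeasurableSet.univ, Set.preimage_univ,
              ← Set.univ_prod_univ, Measure.prod_prod]
            simpa using h1
        _ = ENNReal.ofReal (∑ L : Fin n, wt L) := by
            rw [ENNReal.ofReal_sum_of_nonneg fun L _ => (wt_pos _).le]
            simp
        _ ≤ 1 := by
            rw [← ENNReal.ofReal_one]
            exact ENNReal.ofReal_le_ofReal (sum_wt n)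

instance (n : ℕ) : IsFiniteMeasure (nu R n) := ⟨(nu_mass R n).trans_lt ENNReal.one_lt_top⟩

lemma sum_nu (n : ℕ) : ∑ s, wp (nu R n) n s ≤ 1 := by
  rw [sum_wp]
  exact ENNReal.toReal_le_of_le_ofReal zero_le_one (by simpa using nu_mass R n)

lemma nu_block (m L : ℕ) (hL : 1 ≤ L) (x : ℕ → A) :
    wt (L - 1) * cp R L x * cp (nu R m) m (sh^[L] x) ≤ cp (nu R (m + L)) (m + L) x := by
  have key : ENNReal.ofReal (wt (L - 1)) * (R (cyl L x) * nu R m (cyl m (sh^[L] x))) ≤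
      nu R (m + L) (cyl (m + L) x) := by
    conv_rhs => rw [nu]
    rw [if_neg (by omega)]
    simp only [Measure.coe_finsetSum, Finset.sum_apply, Measure.coe_smul, Pi.smul_apply, smul_eq_mul]
    refine le_trans ?_ (Finset.single_le_sum (fun _ _ => zero_le) (Finset.mem_univ (⟨L - 1, by omega⟩ : Fin (m + L))))
    simp only
    gcongr
    have e1 : m + L - 1 - (L - 1) = m := by omega
    have e2 : L - 1 + 1 = L := by omega
    rw [e1, e2, Measure.map_apply (measurable_cat _) (measurableSet_cyl _ _), ← Measure.prod_prod]
    refine measure_mono ?_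
    rintro ⟨z, y⟩ ⟨hz, hy⟩ i hi
    simp only [cat]
    split_ifs with h
    · exact hz i h
    · have := hy (i - L) (by omega)
      rw [sh_iterate] at this
      simp only at this ⊢
      rw [this]
      congr 1
      omega
  rw [cp_eq, cp_eq, cp_eq]
  have := ENNReal.toReal_mono (measure_ne_top _ _) key
  rw [ENNReal.toReal_mul, ENNReal.toReal_mul, ENNReal.toReal_ofReal (wt_pos _).le] at this
  rw [mul_assoc]
  exact this

lemma nu_pos (hR : ∀ n (x : ℕ → A), 0 < cp R n x) (n : ℕ) (x : ℕ → A) : 0 < cp (nu R n) n x := by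
  have h0 : ∀ y : ℕ → A, 0 < cp (nu R 0) 0 y := fun y => by rw [nu_zero]; exact hR 0 y
  rcases Nat.eq_zero_or_pos n with rfl | hn
  · exact h0 x
  · have := nu_block R 0 n hn x
    rw [zero_add] at this
    exact lt_of_lt_of_le (mul_pos (mul_pos (wt_pos _) (hR _ _)) (h0 _)) this

/-- Code lengths. -/
noncomputable def VV (n : ℕ) (x : ℕ → A) : ℝ := - log (cp (nu R n) n x)

lemma VV_block (hR : ∀ n (x : ℕ → A), 0 < cp R n x) (m L : ℕ) (hL : 1 ≤ L) (x : ℕ → A) :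
    VV R (m + L) x ≤ - log (wt (L - 1)) + - log (cp R L x) + VV R m (sh^[L] x) := by
  unfold VV
  have h1 := hR L x
  have h2 := nu_pos R hR m (sh^[L] x)
  have h3 := wt_pos (L - 1)
  have := Real.log_le_log (by positivity) (nu_block R m L hL x)
  rw [Real.log_mul (by positivity) h2.ne', Real.log_mul h3.ne' h1.ne'] at this
  linarith

lemma VV_zero (x : ℕ → A) : VV R 0 x = 0 := by
  unfold VV
  rw [nu_zero, cp_eq]
  have : cyl 0 x = Set.univ := by ext; simp [cyl]
  rw [this]; simp

lemma cp_le_one (n : ℕ) (x : ℕ → A) : cp R n x ≤ 1 := by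
  rw [cp_eq]; exact measureReal_le_one

lemma VV_step (hR : ∀ n (x : ℕ → A), 0 < cp R n x) : ∃ C : ℝ, 0 ≤ C ∧ ∀ n (x : ℕ → A), VV R (n + 1) x ≤ C + VV R n (sh x) := by
  obtain ⟨M, hM⟩ := Finite.exists_le (fun s : Fin 1 → A => - log (wp R 1 s))
  refine ⟨|- log (wt 0) + M|, abs_nonneg _, fun n x => ?_⟩
  have h1 := VV_block R hR n 1 le_rfl x
  have h2 : - log (cp R 1 x) ≤ M := hM (rr 1 x)
  have h3 := le_abs_self (- log (wt 0) + M)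
  simp only [Nat.sub_self, Function.iterate_one] at h1
  linarith

lemma VV_integrable (P : Measure (ℕ → A)) [IsFiniteMeasure P] (n : ℕ) : Integrable (VV R n) P :=
  integrable_rr P n (fun s => - log (wp (nu R n) n s))

end Renewal

section SMB
variable {A : Type*} [MeasurableSpace A] [MeasurableSingletonClass A] [Fintype A]

lemma cost_small (ε : ℝ) (hε : 0 < ε) :
    ∀ᶠ L : ℕ in atTop, - log (wt (L - 1)) + log 2 ≤ ε * L := by
  have h1 : ∀ᶠ L : ℕ in atTop, log (L : ℝ) ≤ ε / 4 * L := by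
    have := (Real.isLittleO_log_id_atTop.comp_tendsto (tendsto_natCast_atTop_atTop (R := ℝ))).bound
      (show (0 : ℝ) < ε / 4 by linarith)
    filter_upwards [this] with L hL
    simp only [Function.comp, id, Real.norm_eq_abs] at hL
    rw [abs_of_nonneg (by positivity : (0 : ℝ) ≤ (L : ℝ))] at hL
    exact (le_abs_self _).trans hL
  have h2 : ∀ᶠ L : ℕ in atTop, log 4 ≤ ε / 4 * L := by
    obtain ⟨N, hN⟩ := exists_nat_ge (log 4 / (ε / 4))
    filter_upwards [eventually_ge_atTop N] with L hL
    rw [div_le_iff₀ (by linarith)] at hN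
    have : (N : ℝ) ≤ L := by exact_mod_cast hL
    nlinarith
  filter_upwards [h1, h2, eventually_ge_atTop 1] with L h1 h2 hL
  have hL' : (1 : ℝ) ≤ L := by exact_mod_cast hL
  have e : wt (L - 1) = 1 / ((L : ℝ) * (L + 1)) := by
    unfold wt
    rw [Nat.cast_sub hL]
    push_cast
    congr 2 <;> ring
  have h3 : log ((L : ℝ) * (L + 1) * 2) ≤ log (4 * L * L) := by
    apply Real.log_le_log (by positivity)
    nlinarith
  have e1 : log ((L : ℝ) * (L + 1) * 2) = log ((L : ℝ) * (L + 1)) + log 2 :=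
    Real.log_mul (by positivity) (by positivity)
  have e2 : log (4 * (L : ℝ) * L) = log 4 + log L + log L := by
    rw [Real.log_mul (by positivity) (by positivity), Real.log_mul (by positivity) (by positivity)]
  rw [e, one_div, Real.log_inv, neg_neg]
  have hpos : (0 : ℝ) ≤ ε * L := by positivity
  linarith

variable (P R : Measure (ℕ → A)) [IsProbabilityMeasure P] [IsProbabilityMeasure R]

lemma VV_le (C : ℝ)
    (hC : ∀ n (x : ℕ → A), VV R (n + 1) x ≤ C + VV R n (sh x)) (j n : ℕ) (x : ℕ → A) :
    VV R (n + j) x ≤ C * j + VV R n (sh^[j] x) := by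
  induction j generalizing x with
  | zero => simp
  | succ j ih =>
    have h1 := hC (n + j) x
    have h2 := ih (sh x)
    rw [Function.iterate_succ_apply]
    push_cast
    rw [← add_assoc]
    linarith

/-- Averaging over the phases of a block parsing. -/
lemma VV_phase (hR : ∀ n (x : ℕ → A), 0 < cp R n x) (k : ℕ) :
    ∃ K : ℝ, ∀ n, k ≤ n → ∀ x : ℕ → A, (k + 1) * VV R n x ≤
      birkhoffSum sh (fun x => - log (wt k) + - log (cp R (k + 1) x)) n x + K := by
  obtain ⟨C, hC0, hC⟩ := VV_step R hR
  set g : (ℕ → A) → ℝ := fun x => - log (wt k) + - log (cp R (k + 1) x) with hg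
  have hg0 : ∀ x, 0 ≤ g x := by
    intro x
    have h1 := Real.log_nonpos (wt_pos k).le (wt_le_one k)
    have h2 := Real.log_nonpos (hR (k + 1) x).le (cp_le_one R (k + 1) x)
    simp only [hg]; linarith
  set W : ℕ → (ℕ → A) → ℝ := fun m x =>
    ∑ j ∈ Finset.range (k + 1), VV R (m + (k - j)) (sh^[j] x) with hW
  have hW1 : ∀ m x, W (m + 1) x ≤ g x + W m (sh x) := by
    intro m x
    simp only [hW]
    rw [Finset.sum_range_succ', Finset.sum_range_succ (n := k)]
    have e : ∑ j ∈ Finset.range k, VV R (m + 1 + (k - (j + 1))) (sh^[j + 1] x) =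
        ∑ j ∈ Finset.range k, VV R (m + (k - j)) (sh^[j] (sh x)) := by
      refine Finset.sum_congr rfl fun j hj => ?_
      have := Finset.mem_range.1 hj
      rw [Function.iterate_succ_apply]
      congr 1
      omega
    rw [e]
    have hb := VV_block R hR m (k + 1) (by omega) x
    rw [Function.iterate_succ_apply] at hb
    simp only [Nat.add_sub_cancel] at hb
    have e2 : m + 1 + (k - 0) = m + (k + 1) := by omega
    have e3 : m + (k - k) = m := by omega
    rw [e2, e3, Function.iterate_zero, id]
    simp only [hg]
    linarith
  have hW0 : ∀ x, W 0 x ≤ (k + 1) * (C * k) := by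
    intro x
    have : W 0 x ≤ ∑ j ∈ Finset.range (k + 1), C * k := by
      refine Finset.sum_le_sum fun j _ => ?_
      have h1 := VV_le R C hC (k - j) 0 (sh^[j] x)
      rw [VV_zero] at h1
      have h2 : ((k - j : ℕ) : ℝ) ≤ k := by exact_mod_cast Nat.sub_le _ _
      nlinarith
    simpa using this
  have hWb : ∀ m x, W m x ≤ birkhoffSum sh g m x + (k + 1) * (C * k) := by
    intro m
    induction m with
    | zero => intro x; simpa [birkhoffSum] using hW0 x
    | succ m ih =>
      intro x
      rw [birkhoffSum_succ']
      have := hW1 m x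
      have := ih (sh x)
      linarith
  refine ⟨2 * ((k + 1) * (C * k)), fun n hn x => ?_⟩
  obtain ⟨m, rfl⟩ : ∃ m, n = m + k := ⟨n - k, by omega⟩
  have h1 : (k + 1) * VV R (m + k) x ≤ (k + 1) * (C * k) + W m x := by
    have : ∑ j ∈ Finset.range (k + 1), VV R (m + k) x ≤
        ∑ j ∈ Finset.range (k + 1), (C * k + VV R (m + (k - j)) (sh^[j] x)) := by
      refine Finset.sum_le_sum fun j hj => ?_
      have hj' : j ≤ k := by have := Finset.mem_range.1 hj; omega
      have h1 := VV_le R C hC j (m + (k - j)) x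
      have e : m + (k - j) + j = m + k := by omega
      rw [e] at h1
      have h2 : (j : ℝ) ≤ k := by exact_mod_cast hj'
      nlinarith
    rw [Finset.sum_add_distrib] at this
    simpa using this
  have h2 := hWb m x
  have h3 : birkhoffSum sh g m x ≤ birkhoffSum sh g (m + k) x := by
    rw [birkhoffSum_add]
    have : 0 ≤ birkhoffSum sh g k (sh^[m] x) := Finset.sum_nonneg fun _ _ => hg0 _
    linarith
  linarith

lemma smb_upper (hP : Ergodic (sh : (ℕ → A) → ℕ → A) P)
    (hR : ∀ n (x : ℕ → A), 0 < cp R n x) (hPR : ∀ n (x : ℕ → A), cp P n x ≤ 2 * cp R n x) (h : ℝ)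
    (hh : Tendsto (fun n : ℕ => (n : ℝ)⁻¹ * ∫ x, - log (cp P n x) ∂P) atTop (nhds h))
    (c : ℝ) (hc : h < c) :
    ∀ᵐ x ∂P, ∀ᶠ n : ℕ in atTop, - log (cp P n x) ≤ c * n := by
  obtain ⟨ε, hε, rfl⟩ : ∃ ε > 0, c = h + 5 * ε := ⟨(c - h) / 5, by linarith, by ring⟩
  obtain ⟨k', hk1, hk2, hk3⟩ := ((hh.eventually_lt_const (show h < h + ε by linarith)).and
    ((cost_small ε hε).and (eventually_ge_atTop 1))).exists
  obtain ⟨k, rfl⟩ : ∃ k, k' = k + 1 := ⟨k' - 1, by omega⟩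
  have hkpos : (0 : ℝ) < ((k + 1 : ℕ) : ℝ) := by positivity
  rw [inv_mul_lt_iff₀ hkpos] at hk1
  rw [Nat.add_sub_cancel] at hk2
  set g : (ℕ → A) → ℝ := fun x => - log (wt k) + - log (cp R (k + 1) x) with hg
  have hgm : Measurable g :=
    measurable_comp_rr (k + 1) (fun s => - log (wt k) + - log (wp R (k + 1) s))
  have hgi : Integrable g P :=
    integrable_rr P (k + 1) (fun s => - log (wt k) + - log (wp R (k + 1) s))
  have hii : Integrable (fun x => - log (cp P (k + 1) x)) P :=
    integrable_rr P (k + 1) (fun s => - log (wp P (k + 1) s))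
  obtain ⟨B, hB⟩ := Finite.exists_le (fun s : Fin (k + 1) → A => |- log (wt k) + - log (wp R (k + 1) s)|)
  have hgint : ∫ x, g x ∂P ≤ (ε + (h + ε)) * ((k + 1 : ℕ) : ℝ) := by
    have h1 : ∫ x, g x ∂P ≤ ∫ x, (ε * ((k + 1 : ℕ) : ℝ) + - log (cp P (k + 1) x)) ∂P := by
      refine integral_mono_ae hgi ((integrable_const _).add hii) ?_
      filter_upwards [cp_pos_ae P] with x hx
      have h2 := Real.log_le_log (hx (k + 1)) (hPR (k + 1) x)
      rw [Real.log_mul (by norm_num) (hR _ _).ne'] at h2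
      simp only [hg]
      linarith
    rw [integral_add (integrable_const _) hii] at h1
    simp only [integral_const, probReal_univ, smul_eq_mul, one_mul] at h1
    linarith
  obtain ⟨K, hK⟩ := VV_phase R hR k
  have hb := birkhoff_upper hP g hgm B (fun x => hB (rr (k + 1) x))
    ((h + 3 * ε) * ((k + 1 : ℕ) : ℝ)) (by nlinarith)
  have hcmp := compare_ae P (fun n s => wp (nu R n) n s) (fun n s => wp_nonneg _ _ _)
    (fun n => sum_nu R n) ε hε
  filter_upwards [hb, hcmp] with x hb hcmp
  obtain ⟨M, hM⟩ := exists_nat_ge (K / ε)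
  rw [div_le_iff₀ hε] at hM
  filter_upwards [hb, hcmp, eventually_ge_atTop k, eventually_ge_atTop M] with n hb hcmp hn hnM
  have h1 := hK n hn x
  have hpos := nu_pos R hR n x
  have h2 : cp (nu R n) n x ≤ exp (ε * n) * cp P n x := hcmp
  have hpp : 0 < cp P n x := by
    have := lt_of_lt_of_le hpos h2
    exact pos_of_mul_pos_right this (exp_pos _).le
  have h3 := Real.log_le_log hpos h2
  rw [Real.log_mul (exp_pos _).ne' hpp.ne', Real.log_exp] at h3
  have h4 : (M : ℝ) ≤ n := by exact_mod_cast hnM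
  have h5 : VV R n x ≤ (h + 4 * ε) * n := by
    have h6 : (k + 1 : ℝ) * VV R n x ≤ (k + 1 : ℝ) * ((h + 4 * ε) * n) := by
      have h7 : K ≤ ε * n := by nlinarith
      have h8 : ε * n ≤ (k + 1) * (ε * n) := by
        have : (0 : ℝ) ≤ ε * n := by positivity
        have : (0 : ℝ) ≤ k := by positivity
        nlinarith
      push_cast at hb
      nlinarith
    exact le_of_mul_le_mul_left h6 (by positivity)
  unfold VV at h5
  linarith

lemma cp_shift (hP : MeasurePreserving (sh : (ℕ → A) → ℕ → A) P P) (n : ℕ) (x : ℕ → A) :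
    cp P (n + 1) x ≤ cp P n (sh x) := by
  rw [cp_eq, cp_eq, ← hP.measureReal_preimage (measurableSet_cyl n (sh x)).nullMeasurableSet]
  refine measureReal_mono ?_
  intro z hz i hi
  exact hz (i + 1) (by omega)

lemma smb_lower (hP : Ergodic (sh : (ℕ → A) → ℕ → A) P)
    (hR : ∀ n (x : ℕ → A), 0 < cp R n x) (hPR : ∀ n (x : ℕ → A), cp P n x ≤ 2 * cp R n x) (h : ℝ)
    (hh : Tendsto (fun n : ℕ => (n : ℝ)⁻¹ * ∫ x, - log (cp P n x) ∂P) atTop (nhds h))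
    (c : ℝ) (hc : c < h) :
    ∀ᵐ x ∂P, ∀ᶠ n : ℕ in atTop, c * n ≤ - log (cp P n x) := by
  have hum : ∀ n, Measurable (fun x : ℕ → A => - log (cp P n x)) := fun n =>
    measurable_comp_rr n (fun s => - log (wp P n s))
  rcases dichotomy hP (fun n x => - log (cp P n x)) hum 0 (by
    filter_upwards [cp_pos_ae P] with x hx n
    have := Real.log_le_log (hx (n + 1)) (cp_shift P hP.toMeasurePreserving n x)
    linarith) c with hd | hd
  · filter_upwards [hd] with x hx
    filter_upwards [hx] with n hn using hn.le
  exfalso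
  obtain ⟨ε, hε, hhε⟩ : ∃ ε > 0, h = c + 4 * ε := ⟨(h - c) / 4, by linarith, by ring⟩
  obtain ⟨M, hM⟩ := eventually_atTop.1 (cost_small ε hε)
  obtain ⟨C, hC0, hC⟩ := VV_step R hR
  obtain ⟨K, hK⟩ := tile_integral (μ := P) hP.toMeasurePreserving (VV R) (VV_integrable R P) C
    (c + 2 * ε) hC0 (fun x => (VV_zero R x).le) hC
    (fun L => {x | (M + 1 ≤ L ∧ 0 < cp P L x) ∧ - log (cp P L x) ≤ (c + ε) * L})
    (fun L => by
      refine MeasurableSet.inter (MeasurableSet.inter (MeasurableSet.const _) ?_) ?_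
      · exact measurableSet_lt measurable_const (measurable_comp_rr L (fun s => wp P L s))
      · exact measurableSet_le (hum L) measurable_const)
    (by
      rintro L n x ⟨⟨h1, h2⟩, h3⟩
      have h4 := VV_block R hR n L (by omega) x
      have h5 := hM L (by omega)
      have h6 := Real.log_le_log h2 (hPR L x)
      rw [Real.log_mul (by norm_num) (hR _ _).ne'] at h6
      linarith)
    (by
      filter_upwards [hd, cp_pos_ae P] with x ⟨K, hK⟩ hx
      obtain ⟨M', hM'⟩ := exists_nat_ge (K / ε)
      obtain ⟨n, hn, hn2⟩ := (frequently_atTop.1 hK) (M + M' + 1)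
      refine ⟨n, by omega, ⟨⟨by omega, hx n⟩, ?_⟩⟩
      rw [div_le_iff₀ hε] at hM'
      have : (M' : ℝ) ≤ n := by exact_mod_cast (by omega : M' ≤ n)
      nlinarith) (ε / 2) (by linarith)
  have hbound : ∀ n : ℕ, ∫ x, - log (cp P n x) ∂P ≤ (c + 2 * ε + ε / 2) * n + K := fun n =>
    (gibbs P n (fun s => wp (nu R n) n s) (fun s => by
      by_cases hA : Nonempty A
      · obtain ⟨a⟩ := hA
        have := nu_pos R hR n (fun i => if h : i < n then s ⟨i, h⟩ else a)
        have e : rr n (fun i => if h : i < n then s ⟨i, h⟩ else a) = s := by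
          ext i
          simp [rr]
        unfold cp at this
        rw [e] at this
        exact this
      · exfalso
        have : IsEmpty (ℕ → A) := ⟨fun f => hA ⟨f 0⟩⟩
        exact (IsProbabilityMeasure.ne_zero P) (Measure.eq_zero_of_isEmpty P)) (sum_nu R n)).trans (hK n)
  obtain ⟨N, hN⟩ := exists_nat_ge (K / ε)
  rw [div_le_iff₀ hε] at hN
  obtain ⟨n, h1, h2, h3⟩ := ((hh.eventually_const_lt (show h - ε / 2 < h by linarith)).and
    ((eventually_ge_atTop N).and (eventually_gt_atTop 0))).exists
  have hnpos : (0 : ℝ) < n := by exact_mod_cast h3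
  rw [lt_inv_mul_iff₀ hnpos] at h1
  have h4 := hbound n
  have h5 : (N : ℝ) ≤ n := by exact_mod_cast h2
  nlinarith

/-- Shannon-McMillan-Breiman. -/
lemma smb (hP : Ergodic (sh : (ℕ → A) → ℕ → A) P)
    (hR : ∀ n (x : ℕ → A), 0 < cp R n x) (hPR : ∀ n (x : ℕ → A), cp P n x ≤ 2 * cp R n x) (h : ℝ)
    (hh : Tendsto (fun n : ℕ => (n : ℝ)⁻¹ * ∫ x, - log (cp P n x) ∂P) atTop (nhds h)) :
    ∀ᵐ x ∂P, Tendsto (fun n : ℕ => (n : ℝ)⁻¹ * - log (cp P n x)) atTop (nhds h) :=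
  tendsto_of_bounds (fun n x => - log (cp P n x)) h (smb_lower P R hP hR hPR h hh)
    (smb_upper P R hP hR hPR h hh)

end SMB

section Balls
variable {A : Type*} [Fintype A]

/-- Exponential bound on the weight of a small distortion ball. -/
lemma ball_weight (σ : A → A → ℝ) (h0 : ∀ x y, 0 ≤ σ x y) (hz : ∀ x y, σ x y = 0 ↔ x = y)
    (q : A → ℝ) (hq : ∀ a, 0 < q a) (η : ℝ) (hη : 0 < η) :
    ∃ D0 > 0, ∀ (n : ℕ) (x : Fin n → A) (S : Finset (Fin n → A)),
      (∀ y ∈ S, (n : ℝ)⁻¹ * ∑ i, σ (x i) (y i) ≤ D0) →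
      ∑ y ∈ S, ∏ i, q (y i) ≤ exp (η * n) * ∏ i, q (x i) := by
  classical
  have hlim : ∀ a, Tendsto (fun l : ℝ => ∑ b, q b * exp (-(l * σ a b))) atTop (nhds (q a)) := by
    intro a
    have : Tendsto (fun l : ℝ => ∑ b, q b * exp (-(l * σ a b))) atTop
        (nhds (∑ b, if b = a then q b else 0)) := by
      refine tendsto_finsetSum _ fun b _ => ?_
      split_ifs with hb
      · have : σ a b = 0 := (hz a b).2 hb.symm
        simp [this]
      · have hpos : 0 < σ a b := lt_of_le_of_ne (h0 a b) fun h => hb ((hz a b).1 h.symm).symm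
        have h1 : Tendsto (fun l : ℝ => l * σ a b) atTop atTop := tendsto_id.atTop_mul_const hpos
        have h2 := (Real.tendsto_exp_neg_atTop_nhds_zero.comp h1).const_mul (q b)
        simpa using h2
    simpa using this
  have hev : ∀ᶠ l : ℝ in atTop, ∀ a, ∑ b, q b * exp (-(l * σ a b)) < q a * exp (η / 2) := by
    rw [eventually_all]
    intro a
    refine (hlim a).eventually_lt_const ?_
    have : 1 < exp (η / 2) := by rw [Real.one_lt_exp_iff]; linarith
    have := hq a
    nlinarith
  obtain ⟨l, hl, hlpos⟩ := (hev.and (eventually_gt_atTop 0)).exists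
  refine ⟨η / (2 * l), by positivity, fun n x S hS => ?_⟩
  have hterm : ∀ y ∈ S, ∏ i, q (y i) ≤
      exp (η / 2 * n) * ∏ i, (q (y i) * exp (-(l * σ (x i) (y i)))) := by
    intro y hy
    rw [Finset.prod_mul_distrib, ← Real.exp_sum, Finset.sum_neg_distrib, ← Finset.mul_sum]
    have h1 : ∑ i, σ (x i) (y i) ≤ η / (2 * l) * n := by
      rcases Nat.eq_zero_or_pos n with rfl | hn
      · simp
      · have := hS y hy
        rw [inv_mul_le_iff₀ (by exact_mod_cast hn)] at this
        linarith
    have h2 : l * ∑ i, σ (x i) (y i) ≤ η / 2 * n := by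
      calc l * ∑ i, σ (x i) (y i) ≤ l * (η / (2 * l) * n) := by gcongr
        _ = η / 2 * n := by field_simp
    have h3 : 0 ≤ ∏ i, q (y i) := Finset.prod_nonneg fun i _ => (hq _).le
    have h4 : 1 ≤ exp (η / 2 * n) * exp (-(l * ∑ i, σ (x i) (y i))) := by
      rw [← Real.exp_add]
      exact Real.one_le_exp (by linarith)
    nlinarith
  calc ∑ y ∈ S, ∏ i, q (y i)
      ≤ ∑ y ∈ S, exp (η / 2 * n) * ∏ i, (q (y i) * exp (-(l * σ (x i) (y i)))) :=
        Finset.sum_le_sum hterm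
    _ ≤ ∑ y : Fin n → A, exp (η / 2 * n) * ∏ i, (q (y i) * exp (-(l * σ (x i) (y i)))) := by
        refine Finset.sum_le_sum_of_subset_of_nonneg (Finset.subset_univ _) fun y _ _ => ?_
        exact mul_nonneg (exp_pos _).le
          (Finset.prod_nonneg fun i _ => mul_nonneg (hq _).le (exp_pos _).le)
    _ = exp (η / 2 * n) * ∏ i, ∑ b, q b * exp (-(l * σ (x i) b)) := by
        rw [← Finset.mul_sum, Fintype.prod_sum]
    _ ≤ exp (η / 2 * n) * ∏ i, (q (x i) * exp (η / 2)) := by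
        gcongr with i _
        · intro i _
          exact Finset.sum_nonneg fun b _ => mul_nonneg (hq _).le (exp_pos _).le
        · exact (hl (x i)).le
    _ = exp (η * n) * ∏ i, q (x i) := by
        rw [Finset.prod_mul_distrib, Finset.prod_const, Finset.card_univ, Fintype.card_fin,
          ← Real.exp_nat_mul, mul_comm (∏ i, q (x i)), ← mul_assoc, ← Real.exp_add]
        congr 2
        ring

end Balls

section Final
variable {A : Type*} [MeasurableSpace A] [MeasurableSingletonClass A] [Fintype A]

lemma exists_dominating (P : Measure (ℕ → A)) [IsProbabilityMeasure P]
    (Q : Measure A) [IsProbabilityMeasure Q] (hfull : ∀ a : A, 0 < Q {a}) :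
    ∃ R : Measure (ℕ → A), IsProbabilityMeasure R ∧ (∀ n (x : ℕ → A), 0 < cp R n x) ∧
      ∀ n (x : ℕ → A), cp P n x ≤ 2 * cp R n x := by
  set U : Measure (ℕ → A) := Measure.infinitePi (fun _ : ℕ => Q) with hU
  have hUpos : ∀ n (x : ℕ → A), 0 < cp U n x := by
    intro n x
    have e : cyl n x = Set.pi (Finset.range n : Set ℕ) (fun i => {x i}) := by
      ext z
      simp [cyl, Set.mem_pi]
    rw [cp_eq, e, hU, Measure.real, Measure.infinitePi_pi _ (fun i _ => measurableSet_singleton _),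
      ENNReal.toReal_prod]
    exact Finset.prod_pos fun i _ => ENNReal.toReal_pos (hfull _).ne' (measure_ne_top _ _)
  have hp : IsProbabilityMeasure ((2 : ENNReal)⁻¹ • (P + U)) := by
    refine ⟨?_⟩
    simp only [Measure.smul_apply, Measure.add_apply, measure_univ, smul_eq_mul]
    rw [one_add_one_eq_two]
    exact ENNReal.inv_mul_cancel (by norm_num) (by norm_num)
  have hval : ∀ n (x : ℕ → A), cp ((2 : ENNReal)⁻¹ • (P + U)) n x = 2⁻¹ * (cp P n x + cp U n x) := by
    intro n x
    rw [cp_eq, cp_eq, cp_eq, measureReal_ennreal_smul_apply, measureReal_add_apply]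
    simp
  refine ⟨_, hp, fun n x => ?_, fun n x => ?_⟩
  · rw [hval]
    have := hUpos n x
    have := cp_nonneg P n x
    linarith
  · rw [hval]
    have := hUpos n x
    linarith

lemma pball_le (P : Measure (ℕ → A)) [IsProbabilityMeasure P]
    (ρ : A → A → ℝ) (hρ0 : ∀ x y, 0 ≤ ρ x y) (hρzero : ∀ x y, ρ x y = 0 ↔ x = y)
    (η : ℝ) (hη : 0 < η) : ∃ D0 > 0, ∀ᵐ x ∂P, ∀ᶠ n : ℕ in atTop,
      P.real {z | (n : ℝ)⁻¹ * ∑ i : Fin n, ρ (x i) (z i) ≤ D0} ≤ exp (2 * η * n) * cp P n x := by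
  classical
  obtain ⟨D0, hD0, hD⟩ := ball_weight (fun a b => ρ b a) (fun x y => hρ0 y x)
    (fun x y => (hρzero y x).trans eq_comm) (fun _ => 1) (fun _ => one_pos) η hη
  refine ⟨D0, hD0, ?_⟩
  let S : ∀ n, (Fin n → A) → Finset (Fin n → A) := fun n s =>
    Finset.univ.filter fun y => (n : ℝ)⁻¹ * ∑ i : Fin n, ρ (s i) (y i) ≤ D0
  have hcmp := compare_ae P (fun n s => exp (-(η * n)) * ∑ y ∈ S n s, wp P n y)
    (fun n s => mul_nonneg (exp_pos _).le (Finset.sum_nonneg fun y _ => wp_nonneg _ _ _))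
    (fun n => by
      rw [← Finset.mul_sum]
      have h1 : ∑ s, ∑ y ∈ S n s, wp P n y ≤ exp (η * n) := by
        calc ∑ s, ∑ y ∈ S n s, wp P n y
            = ∑ y, ∑ s ∈ Finset.univ.filter (fun s => y ∈ S n s), wp P n y := by
              simp only [Finset.sum_filter, S]
              rw [Finset.sum_comm]
              simp
          _ ≤ ∑ y, exp (η * n) * wp P n y := by
              refine Finset.sum_le_sum fun y _ => ?_
              have h2 := hD n y (Finset.univ.filter (fun s => y ∈ S n s)) (by
                intro s hs
                simpa [S] using hs)
              simp only [Finset.prod_const_one, Finset.sum_const, nsmul_eq_mul, mul_one] at h2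
              rw [Finset.sum_const, nsmul_eq_mul]
              exact mul_le_mul_of_nonneg_right h2 (wp_nonneg _ _ _)
          _ = exp (η * n) := by
              rw [← Finset.mul_sum, sum_wp]
              simp
      calc exp (-(η * n)) * ∑ s, ∑ y ∈ S n s, wp P n y ≤ exp (-(η * n)) * exp (η * n) := by gcongr
        _ = 1 := by rw [← Real.exp_add]; simp) η hη
  filter_upwards [hcmp] with x hx
  filter_upwards [hx] with n hn
  have e : {z : ℕ → A | (n : ℝ)⁻¹ * ∑ i : Fin n, ρ (x i) (z i) ≤ D0} =
      rr n ⁻¹' (S n (rr n x) : Set (Fin n → A)) := by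
    ext z
    simp only [Set.mem_preimage, Finset.mem_coe, S, Finset.mem_filter, Finset.mem_univ, true_and]
    rfl
  rw [e, real_preimage]
  have h3 := mul_le_mul_of_nonneg_left hn (exp_pos (η * n)).le
  rw [← mul_assoc, ← mul_assoc, ← Real.exp_add, ← Real.exp_add] at h3
  have e1 : η * n + -(η * n) = 0 := by ring
  have e2 : η * n + η * n = 2 * η * n := by ring
  rw [e1, e2, Real.exp_zero, one_mul] at h3
  exact h3

lemma pi_singleton_real (Q : Measure A) [IsProbabilityMeasure Q] (n : ℕ) (s : Fin n → A) :
    ((Measure.pi (fun _ : Fin n => Q)) {s}).toReal = ∏ i, Q.real {s i} := by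
  rw [Measure.pi_singleton, ENNReal.toReal_prod]
  rfl

lemma qball_le (Q : Measure A) [IsProbabilityMeasure Q] (hfull : ∀ a : A, 0 < Q {a})
    (ρ : A → A → ℝ) (hρ0 : ∀ x y, 0 ≤ ρ x y) (hρzero : ∀ x y, ρ x y = 0 ↔ x = y)
    (η : ℝ) (hη : 0 < η) : ∃ D0 > 0, ∀ (n : ℕ) (x : Fin n → A),
      (Measure.pi (fun _ : Fin n => Q)).real {y | (n : ℝ)⁻¹ * ∑ i : Fin n, ρ (x i) (y i) ≤ D0} ≤
        exp (η * n) * ∏ i, Q.real {x i} := by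
  classical
  obtain ⟨D0, hD0, hD⟩ := ball_weight ρ hρ0 hρzero (fun a => Q.real {a})
    (fun a => ENNReal.toReal_pos (hfull a).ne' (measure_ne_top _ _)) η hη
  refine ⟨D0, hD0, fun n x => ?_⟩
  have h := hD n x (Finset.univ.filter fun y => (n : ℝ)⁻¹ * ∑ i : Fin n, ρ (x i) (y i) ≤ D0)
    (by intro y hy; simpa using hy)
  refine le_trans (le_of_eq ?_) h
  have e : {y : Fin n → A | (n : ℝ)⁻¹ * ∑ i : Fin n, ρ (x i) (y i) ≤ D0} =
      ((Finset.univ.filter fun y => (n : ℝ)⁻¹ * ∑ i : Fin n, ρ (x i) (y i) ≤ D0 :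
        Finset (Fin n → A)) : Set (Fin n → A)) := by
    ext y; simp
  rw [e, ← sum_measureReal_singleton]
  refine Finset.sum_congr rfl fun y _ => ?_
  exact pi_singleton_real Q n y

lemma entropy_split (P : Measure (ℕ → A)) [IsProbabilityMeasure P]
    (hP : MeasurePreserving (sh : (ℕ → A) → ℕ → A) P P)
    (Q : Measure A) [IsProbabilityMeasure Q] (hfull : ∀ a : A, 0 < Q {a}) (n : ℕ) :
    ∑ s : Fin n → A, wp P n s * log (wp P n s / ∏ i, Q.real {s i}) =
      - (∫ x, - log (cp P n x) ∂P) - n * ∫ x, log (Q.real {x 0}) ∂P := by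
  have hq : ∀ a, 0 < Q.real {a} := fun a => ENNReal.toReal_pos (hfull a).ne' (measure_ne_top _ _)
  have e1 : ∫ x, - log (cp P n x) ∂P = ∑ s, wp P n s * - log (wp P n s) :=
    integral_rr P n (fun s => - log (wp P n s))
  have hi : Integrable (fun x : ℕ → A => log (Q.real {x 0})) P :=
    integrable_rr P 1 (fun s => log (Q.real {s 0}))
  have e2 := (integral_birkhoffSum hP _ hi n).2
  have e3 : ∀ x : ℕ → A, birkhoffSum sh (fun x : ℕ → A => log (Q.real {x 0})) n x =
      ∑ i : Fin n, log (Q.real {rr n x i}) := by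
    intro x
    simp only [birkhoffSum, sh_iterate, zero_add, rr]
    rw [Finset.sum_range]
  simp only [e3] at e2
  rw [integral_rr P n (fun s => ∑ i : Fin n, log (Q.real {s i}))] at e2
  rw [e1, ← e2, ← Finset.sum_neg_distrib, ← Finset.sum_sub_distrib]
  refine Finset.sum_congr rfl fun s _ => ?_
  rcases (wp_nonneg P n s).eq_or_lt with h | h
  · rw [← h]; simp
  · rw [Real.log_div h.ne' (Finset.prod_pos fun i _ => hq _).ne',
      Real.log_prod fun i _ => (hq _).ne']
    ring

end Final

end DVB

/-- Theorem 7 (densities vs. balls, discrete case): for a stationary ergodic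
finite-alphabet process `X ∼ Pproc` and an i.i.d. measure with full-support
marginal `Q`, with `ρ(x,y) = 0` iff `x = y`, the double limit (as `n → ∞` and
`D ↓ 0`, jointly) of `(1/n) log [P_n(B(X₁ⁿ,D)) / Qⁿ(B(X₁ⁿ,D))]` exists a.s. and
equals the relative entropy rate `H(ℙ‖ℚ) = lim_n (1/n) H(P_n‖Qⁿ)`. -/
theorem densities_vs_balls_discrete
    {A : Type*} [MeasurableSpace A] [MeasurableSingletonClass A] [Fintype A]
    (Pproc : Measure (ℕ → A)) [IsProbabilityMeasure Pproc]
    (herg : Ergodic (fun x : ℕ → A => fun n => x (n + 1)) Pproc)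
    (Q : Measure A) [IsProbabilityMeasure Q] (hfull : ∀ a : A, 0 < Q {a})
    (ρ : A → A → ℝ) (hρ0 : ∀ x y, 0 ≤ ρ x y) (hρzero : ∀ x y, ρ x y = 0 ↔ x = y)
    (Hrate : ℝ)
    (hHrate : Tendsto (fun n : ℕ => (n : ℝ)⁻¹ *
        ∑ s : Fin n → A,
          ((Pproc.map (fun x (i : Fin n) => x i)) {s}).toReal *
            Real.log (((Pproc.map (fun x (i : Fin n) => x i)) {s}).toReal /
              ((Measure.pi (fun _ : Fin n => Q)) {s}).toReal))
      atTop (nhds Hrate)) :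
    ∀ᵐ x ∂Pproc, Tendsto (fun nD : ℕ × ℝ =>
        (nD.1 : ℝ)⁻¹ * Real.log (
          (Pproc {z | (nD.1 : ℝ)⁻¹ * ∑ i : Fin nD.1, ρ (x i) (z i) ≤ nD.2}).toReal /
          ((Measure.pi (fun _ : Fin nD.1 => Q))
            {y : Fin nD.1 → A | (nD.1 : ℝ)⁻¹ * ∑ i : Fin nD.1, ρ (x i) (y i) ≤ nD.2}).toReal))
      (atTop ×ˢ nhdsWithin 0 (Set.Ioi 0)) (nhds Hrate) := by
  classical
  have hP : Ergodic (DVB.sh : (ℕ → A) → ℕ → A) Pproc := herg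
  obtain ⟨R, hRp, hR, hPR⟩ := DVB.exists_dominating Pproc Q hfull
  have hq : ∀ a, 0 < Q.real {a} := fun a => ENNReal.toReal_pos (hfull a).ne' (measure_ne_top _ _)
  set φ : (ℕ → A) → ℝ := fun x => log (Q.real {x 0}) with hφ
  have hφm : Measurable φ := DVB.measurable_comp_rr 1 (fun s => log (Q.real {s 0}))
  obtain ⟨B, hB⟩ := Finite.exists_le (fun a : A => |log (Q.real {a})|)
  -- convergence of the empirical log-likelihood under `Q`
  have hbirk : ∀ᵐ x ∂Pproc, Tendsto (fun n : ℕ => (n : ℝ)⁻¹ * birkhoffSum DVB.sh φ n x) atTop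
      (nhds (∫ x, φ x ∂Pproc)) :=
    DVB.tendsto_of_bounds (fun n x => birkhoffSum DVB.sh φ n x) _
      (fun c hc => by
        filter_upwards [DVB.birkhoff_lower hP φ hφm B (fun x => hB (x 0)) c hc] with x hx
        filter_upwards [hx] with n hn using hn.le)
      (fun c hc => by
        filter_upwards [DVB.birkhoff_upper hP φ hφm B (fun x => hB (x 0)) c hc] with x hx
        filter_upwards [hx] with n hn using hn.le)
  have hent : Tendsto (fun n : ℕ => (n : ℝ)⁻¹ * ∫ x, - log (DVB.cp Pproc n x) ∂Pproc) atTop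
      (nhds (- Hrate - ∫ x, φ x ∂Pproc)) := by
    refine (hHrate.neg.sub_const (∫ x, φ x ∂Pproc)).congr' ?_
    filter_upwards [eventually_gt_atTop 0] with n hn
    have hn' : (n : ℝ) ≠ 0 := by exact_mod_cast hn.ne'
    have e := DVB.entropy_split Pproc hP.toMeasurePreserving Q hfull n
    simp only [DVB.pi_singleton_real]
    unfold DVB.wp at e
    rw [e]
    field_simp
    ring
  have hsmb := DVB.smb Pproc R hP hR hPR _ hent
  have hη : ∀ k : ℕ, (0 : ℝ) < 1 / ((k : ℝ) + 1) := fun k => Nat.one_div_pos_of_nat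
  choose D1 hD1 hD1' using fun k : ℕ => DVB.pball_le Pproc ρ hρ0 hρzero _ (hη k)
  choose D2 hD2 hD2' using fun k : ℕ => DVB.qball_le Q hfull ρ hρ0 hρzero _ (hη k)
  filter_upwards [hbirk, hsmb, DVB.cp_pos_ae Pproc, ae_all_iff.2 hD1'] with x hx1 hx2 hx3 hx4
  have hmain : Tendsto (fun n : ℕ => (n : ℝ)⁻¹ * (log (DVB.cp Pproc n x) -
      birkhoffSum DVB.sh φ n x)) atTop (nhds Hrate) := by
    have h := hx2.neg.sub hx1
    have e : -(- Hrate - ∫ x, φ x ∂Pproc) - ∫ x, φ x ∂Pproc = Hrate := by ring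
    rw [e] at h
    refine h.congr fun n => ?_
    ring
  rw [Metric.tendsto_nhds]
  intro ε hε
  obtain ⟨k, hk⟩ := exists_nat_one_div_lt (show (0 : ℝ) < ε / 4 by linarith)
  set η : ℝ := 1 / ((k : ℝ) + 1) with hηdef
  have hη0 : 0 < η := hη k
  have hev1 : ∀ᶠ n : ℕ in atTop, |(n : ℝ)⁻¹ * (log (DVB.cp Pproc n x) -
      birkhoffSum DVB.sh φ n x) - Hrate| < ε / 4 := by
    have := Metric.tendsto_nhds.1 hmain (ε / 4) (by linarith)
    simpa only [Real.dist_eq] using this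
  have hev2 : ∀ᶠ D : ℝ in nhdsWithin 0 (Set.Ioi 0), 0 < D ∧ D < min (D1 k) (D2 k) :=
    Ioo_mem_nhdsGT (lt_min (hD1 k) (hD2 k))
  have hev := (hev1.and ((hx4 k).and (eventually_gt_atTop 0))).prod_mk hev2
  filter_upwards [hev] with nD hnD
  obtain ⟨n, D⟩ := nD
  obtain ⟨⟨h1, h2, hn⟩, hD0, hDlt⟩ := hnD
  simp only at h1 h2 hn hD0 hDlt ⊢
  have hn' : (0 : ℝ) < n := by exact_mod_cast hn
  have hDa : D ≤ D1 k := (hDlt.trans_le (min_le_left _ _)).le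
  have hDb : D ≤ D2 k := (hDlt.trans_le (min_le_right _ _)).le
  have hself : ∀ a, ρ a a = 0 := fun a => (hρzero a a).2 rfl
  -- the `P`-ball
  have p1 : DVB.cp Pproc n x ≤ Pproc.real {z | (n : ℝ)⁻¹ * ∑ i : Fin n, ρ (x i) (z i) ≤ D} := by
    rw [DVB.cp_eq]
    refine measureReal_mono ?_
    intro z hz
    have : ∑ i : Fin n, ρ (x i) (z i) = 0 :=
      Finset.sum_eq_zero fun i _ => by rw [hz i i.2, hself]
    show (n : ℝ)⁻¹ * ∑ i : Fin n, ρ (x i) (z i) ≤ D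
    rw [this, mul_zero]
    exact hD0.le
  have p2 : Pproc.real {z | (n : ℝ)⁻¹ * ∑ i : Fin n, ρ (x i) (z i) ≤ D} ≤
      exp (2 * η * n) * DVB.cp Pproc n x := by
    refine le_trans (measureReal_mono ?_) h2
    intro z hz
    exact le_trans hz hDa
  -- the `Q`-ball
  have q1 : ∏ i : Fin n, Q.real {x i} ≤ (Measure.pi (fun _ : Fin n => Q)).real
      {y : Fin n → A | (n : ℝ)⁻¹ * ∑ i : Fin n, ρ (x i) (y i) ≤ D} := by
    have e := DVB.pi_singleton_real Q n (DVB.rr n x)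
    have e' : ∏ i : Fin n, Q.real {x i} = (Measure.pi (fun _ : Fin n => Q)).real {DVB.rr n x} :=
      e.symm
    rw [e']
    refine measureReal_mono ?_
    intro z hz
    have hz' : z = DVB.rr n x := hz
    have : ∑ i : Fin n, ρ (x i) (z i) = 0 :=
      Finset.sum_eq_zero fun i _ => by rw [hz']; exact hself _
    show (n : ℝ)⁻¹ * ∑ i : Fin n, ρ (x i) (z i) ≤ D
    rw [this, mul_zero]
    exact hD0.le
  have q2 : (Measure.pi (fun _ : Fin n => Q)).real
      {y : Fin n → A | (n : ℝ)⁻¹ * ∑ i : Fin n, ρ (x i) (y i) ≤ D} ≤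
      exp (η * n) * ∏ i : Fin n, Q.real {x i} := by
    refine le_trans (measureReal_mono ?_) (hD2' k n (DVB.rr n x))
    intro z hz
    exact le_trans hz hDb
  have hprod : log (∏ i : Fin n, Q.real {x i}) = birkhoffSum DVB.sh φ n x := by
    rw [Real.log_prod fun i _ => (hq _).ne']
    simp only [birkhoffSum, hφ, DVB.sh_iterate, zero_add]
    rw [Finset.sum_range]
  have hcp := hx3 n
  have hqp : 0 < ∏ i : Fin n, Q.real {x i} := Finset.prod_pos fun i _ => hq _
  have hPB := hcp.trans_le p1
  have hQB := hqp.trans_le q1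
  have l1 := Real.log_le_log hcp p1
  have l2 := Real.log_le_log hPB p2
  have l3 := Real.log_le_log hqp q1
  have l4 := Real.log_le_log hQB q2
  rw [Real.log_mul (exp_pos _).ne' hcp.ne', Real.log_exp] at l2
  rw [Real.log_mul (exp_pos _).ne' hqp.ne', Real.log_exp] at l4
  rw [hprod] at l3 l4
  change dist ((n : ℝ)⁻¹ * log (
      Pproc.real {z | (n : ℝ)⁻¹ * ∑ i : Fin n, ρ (x i) (z i) ≤ D} /
      (Measure.pi (fun _ : Fin n => Q)).real
        {y : Fin n → A | (n : ℝ)⁻¹ * ∑ i : Fin n, ρ (x i) (y i) ≤ D})) Hrate < ε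
  rw [Real.log_div hPB.ne' hQB.ne', Real.dist_eq]
  rw [abs_lt] at h1 ⊢
  have hinv : 0 < (n : ℝ)⁻¹ := inv_pos.2 hn'
  have m1 := mul_le_mul_of_nonneg_left (sub_le_sub l2 l3) hinv.le
  have m2 := mul_le_mul_of_nonneg_left (sub_le_sub l1 l4) hinv.le
  have c1 : (n : ℝ)⁻¹ * (2 * η * n + log (DVB.cp Pproc n x) - birkhoffSum DVB.sh φ n x) =
      2 * η + (n : ℝ)⁻¹ * (log (DVB.cp Pproc n x) - birkhoffSum DVB.sh φ n x) := by
    field_simp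
    ring
  have c2 : (n : ℝ)⁻¹ * (log (DVB.cp Pproc n x) - (η * n + birkhoffSum DVB.sh φ n x)) =
      - η + (n : ℝ)⁻¹ * (log (DVB.cp Pproc n x) - birkhoffSum DVB.sh φ n x) := by
    field_simp
    ring
  rw [c1] at m1
  rw [c2] at m2
  constructor <;> linarith
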